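/- arXiv:0803.3880 — 6 statements merged into one kernel-verified Lean document; each statement's English description precedes it below -/
import Mathlib

section
/- Let β ∈ (0, π/2), r ≥ 0 and D > 0 with D ≥ r·cos⁴β. Then the maximum of T₁(v) = v₁²·(1/cos²β − 1) − (√r + v₂)² − v₃² over all v = (v₁, v₂, v₃) ∈ ℝ³ satisfying v₁² + v₂² + v₃² ≤ D equals D·tan²β − r·sin²β, and this maximum is attained at v* = (√(D − r·cos⁴β), −√r·cos²β, 0) (and likewise at (−√(D − r·cos⁴β), −√r·cos²β, 0)), which satisfies the constraint with equality. -/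
open Real

/-- Theorem 2 of the paper (case α = 0): the maximum of
`T₁(v) = v₁²·(1/cos²β − 1) − (√r + v₂)² − v₃²` over the distortion ball
`v₁² + v₂² + v₃² ≤ D` equals `D·tan²β − r·sin²β`, attained at
`(±√(D − r·cos⁴β), −√r·cos²β, 0)`, which satisfies the constraint with equality. -/
theorem stmt_0 (β r D : ℝ) (hβ : β ∈ Set.Ioo 0 (π / 2)) (hr : 0 ≤ r) (hD : 0 < D)
    (hrD : r * Real.cos β ^ 4 ≤ D) :
    IsGreatest
      {t : ℝ | ∃ v₁ v₂ v₃ : ℝ, v₁ ^ 2 + v₂ ^ 2 + v₃ ^ 2 ≤ D ∧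
        t = v₁ ^ 2 * (1 / Real.cos β ^ 2 - 1) - (Real.sqrt r + v₂) ^ 2 - v₃ ^ 2}
      (D * Real.tan β ^ 2 - r * Real.sin β ^ 2) ∧
    (Real.sqrt (D - r * Real.cos β ^ 4)) ^ 2 + (-(Real.sqrt r) * Real.cos β ^ 2) ^ 2
        + (0 : ℝ) ^ 2 = D ∧
    (Real.sqrt (D - r * Real.cos β ^ 4)) ^ 2 * (1 / Real.cos β ^ 2 - 1)
        - (Real.sqrt r + -(Real.sqrt r) * Real.cos β ^ 2) ^ 2 - (0 : ℝ) ^ 2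
      = D * Real.tan β ^ 2 - r * Real.sin β ^ 2 ∧
    (-(Real.sqrt (D - r * Real.cos β ^ 4))) ^ 2 * (1 / Real.cos β ^ 2 - 1)
        - (Real.sqrt r + -(Real.sqrt r) * Real.cos β ^ 2) ^ 2 - (0 : ℝ) ^ 2
      = D * Real.tan β ^ 2 - r * Real.sin β ^ 2 := by
  have hc : 0 < cos β := cos_pos_of_mem_Ioo ⟨by linarith [hβ.1, pi_pos], hβ.2⟩
  have hc2 : 0 < cos β ^ 2 := by positivity
  have hk : 0 ≤ 1 / cos β ^ 2 - 1 := by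
    rw [sub_nonneg, le_div_iff₀ hc2, one_mul]
    exact cos_sq_le_one β
  have htan : tan β ^ 2 = 1 / cos β ^ 2 - 1 := by
    rw [tan_eq_sin_div_cos, div_pow, sin_sq, sub_div, div_self hc2.ne']
  have hsr : √r ^ 2 = r := sq_sqrt hr
  have hsD : √(D - r * cos β ^ 4) ^ 2 = D - r * cos β ^ 4 := sq_sqrt (sub_nonneg.2 hrD)
  have hconstraint :
      √(D - r * cos β ^ 4) ^ 2 + (-√r * cos β ^ 2) ^ 2 + (0 : ℝ) ^ 2 = D := by
    linear_combination hsD + cos β ^ 4 * hsr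
  have hvalue : √(D - r * cos β ^ 4) ^ 2 * (1 / cos β ^ 2 - 1)
      - (√r + -√r * cos β ^ 2) ^ 2 - (0 : ℝ) ^ 2 = D * tan β ^ 2 - r * sin β ^ 2 := by
    have hfactor : (√r + -√r * cos β ^ 2) ^ 2 = r * (1 - cos β ^ 2) ^ 2 := by
      linear_combination (1 - cos β ^ 2) ^ 2 * hsr
    rw [hsD, htan, sin_sq, hfactor]
    field_simp
    ring
  refine ⟨⟨⟨_, _, _, hconstraint.le, hvalue.symm⟩, ?_⟩, hconstraint, hvalue, ?_⟩
  · rintro _ ⟨v₁, v₂, v₃, hv, rfl⟩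
    have hgap : D * tan β ^ 2 - r * sin β ^ 2
        - (v₁ ^ 2 * (1 / cos β ^ 2 - 1) - (√r + v₂) ^ 2 - v₃ ^ 2)
        = (D - (v₁ ^ 2 + v₂ ^ 2 + v₃ ^ 2)) * (1 / cos β ^ 2 - 1)
          + (v₂ + √r * cos β ^ 2) ^ 2 / cos β ^ 2 + v₃ ^ 2 / cos β ^ 2 := by
      rw [htan, sin_sq]
      nth_rewrite 1 [← hsr]
      field_simp
      ring
    have hslack := mul_nonneg (sub_nonneg.2 hv) hk
    rw [← sub_nonneg, hgap]
    positivity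
  · rwa [neg_sq]
end

section
/- Let β ∈ (0, π/2), r > 0 and D > 0 with r·cos⁴β < D. Then the maximizers of T₁(v) = v₁²·(1/cos²β − 1) − (√r + v₂)² − v₃² over {v ∈ ℝ³ : v₁² + v₂² + v₃² ≤ D} are exactly the two points (√(D − r·cos⁴β), −√r·cos²β, 0) and (−√(D − r·cos⁴β), −√r·cos²β, 0); in particular every maximizer has v₃ = 0 and lies on the boundary v₁² + v₂² = D. -/
open Real

/-- Completing the square: the objective falls short of its maximum over the ball of squared
radius `D` by a nonnegative combination of the slack, `z ^ 2` and `(y + s * c) ^ 2`. -/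
lemma objective_eq_max_sub {c : ℝ} (hc : c ≠ 0) (s D x y z : ℝ) :
    x ^ 2 * (1 / c - 1) - (s + y) ^ 2 - z ^ 2 =
      ((1 / c - 1) * D + s ^ 2 * c - s ^ 2) -
        ((1 / c - 1) * (D - (x ^ 2 + y ^ 2 + z ^ 2)) + 1 / c * z ^ 2
          + 1 / c * (y + s * c) ^ 2) := by
  field_simp
  ring

/-- For `0 < c < 1`, the maximizers of the objective over the ball are the points of the sphere
with `y = -s * c` and `z = 0`. -/
lemma isMaximizer_iff {c s D : ℝ} (hc : 0 < c) (hc1 : c < 1) (hD : s ^ 2 * c ^ 2 ≤ D)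
    (v : ℝ × ℝ × ℝ) :
    (v.1 ^ 2 + v.2.1 ^ 2 + v.2.2 ^ 2 ≤ D ∧
      ∀ w : ℝ × ℝ × ℝ, w.1 ^ 2 + w.2.1 ^ 2 + w.2.2 ^ 2 ≤ D →
        w.1 ^ 2 * (1 / c - 1) - (s + w.2.1) ^ 2 - w.2.2 ^ 2 ≤
          v.1 ^ 2 * (1 / c - 1) - (s + v.2.1) ^ 2 - v.2.2 ^ 2) ↔
    v.1 ^ 2 = D - s ^ 2 * c ^ 2 ∧ v.2.1 = -s * c ∧ v.2.2 = 0 := by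
  have hq : 0 < 1 / c := by positivity
  have hk : 0 < 1 / c - 1 := sub_pos.mpr (one_lt_one_div hc hc1)
  obtain ⟨x, y, z⟩ := v
  simp only [objective_eq_max_sub hc.ne' s D]
  constructor
  · rintro ⟨hv, hmax⟩
    have h := hmax (√(D - s ^ 2 * c ^ 2), -s * c, 0)
    have hS : √(D - s ^ 2 * c ^ 2) ^ 2 = D - s ^ 2 * c ^ 2 := sq_sqrt (sub_nonneg.mpr hD)
    simp only [hS] at h
    have h' := h (by ring_nf; exact le_rfl)
    have hslack : 0 ≤ (1 / c - 1) * (D - (x ^ 2 + y ^ 2 + z ^ 2)) :=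
      mul_nonneg hk.le (sub_nonneg.mpr hv)
    have hz : 0 ≤ 1 / c * z ^ 2 := by positivity
    have hy : 0 ≤ 1 / c * (y + s * c) ^ 2 := by positivity
    have hzero : (1 / c - 1) * (D - (D - s ^ 2 * c ^ 2 + (-s * c) ^ 2 + 0 ^ 2)) + 1 / c * 0 ^ 2
        + 1 / c * (-s * c + s * c) ^ 2 = 0 := by ring
    have hz0 : 1 / c * z ^ 2 = 0 := by linarith
    have hy0 : 1 / c * (y + s * c) ^ 2 = 0 := by linarith
    have hslack0 : (1 / c - 1) * (D - (x ^ 2 + y ^ 2 + z ^ 2)) = 0 := by linarith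
    have hz1 : z = 0 := by simpa [hc.ne'] using hz0
    have hy1 : y + s * c = 0 := by simpa [hc.ne'] using hy0
    have hx1 := (mul_eq_zero.mp hslack0).resolve_left hk.ne'
    have hy2 : y = -s * c := by linarith
    refine ⟨?_, hy2, hz1⟩
    rw [hy2, hz1] at hx1
    linear_combination -hx1
  · rintro ⟨hx, hy, hz⟩
    subst hy hz
    refine ⟨by rw [hx]; ring_nf; exact le_rfl, fun w hw => ?_⟩
    have hslack : 0 ≤ (1 / c - 1) * (D - (w.1 ^ 2 + w.2.1 ^ 2 + w.2.2 ^ 2)) :=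
      mul_nonneg hk.le (sub_nonneg.mpr hw)
    have hz : 0 ≤ 1 / c * w.2.2 ^ 2 := by positivity
    have hy : 0 ≤ 1 / c * (w.2.1 + s * c) ^ 2 := by positivity
    have hzero : (1 / c - 1) * (D - (x ^ 2 + (-s * c) ^ 2 + 0 ^ 2)) + 1 / c * 0 ^ 2
        + 1 / c * (-s * c + s * c) ^ 2 = 0 := by rw [hx]; ring
    linarith

/-- Uniqueness part of Theorem 2 of the paper: the maximizers of
`T₁(v) = v₁²·(1/cos²β − 1) − (√r + v₂)² − v₃²` over the distortion ball
`{v : v₁² + v₂² + v₃² ≤ D}` are exactly the two points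
`(±√(D − r·cos⁴β), −√r·cos²β, 0)`; in particular every maximizer has `v₃ = 0`
and lies on the boundary `v₁² + v₂² = D`. -/
theorem stmt_1 (β r D : ℝ) (hβ : β ∈ Set.Ioo 0 (π / 2)) (hr : 0 < r) (hD : 0 < D)
    (hrD : r * Real.cos β ^ 4 < D) :
    (∀ v : ℝ × ℝ × ℝ,
      (v.1 ^ 2 + v.2.1 ^ 2 + v.2.2 ^ 2 ≤ D ∧
        ∀ w : ℝ × ℝ × ℝ, w.1 ^ 2 + w.2.1 ^ 2 + w.2.2 ^ 2 ≤ D →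
          w.1 ^ 2 * (1 / Real.cos β ^ 2 - 1) - (Real.sqrt r + w.2.1) ^ 2 - w.2.2 ^ 2 ≤
            v.1 ^ 2 * (1 / Real.cos β ^ 2 - 1) - (Real.sqrt r + v.2.1) ^ 2 - v.2.2 ^ 2) ↔
      (v = (Real.sqrt (D - r * Real.cos β ^ 4), -(Real.sqrt r) * Real.cos β ^ 2, 0) ∨
       v = (-(Real.sqrt (D - r * Real.cos β ^ 4)), -(Real.sqrt r) * Real.cos β ^ 2, 0))) ∧
    (∀ v : ℝ × ℝ × ℝ,
      (v.1 ^ 2 + v.2.1 ^ 2 + v.2.2 ^ 2 ≤ D ∧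
        ∀ w : ℝ × ℝ × ℝ, w.1 ^ 2 + w.2.1 ^ 2 + w.2.2 ^ 2 ≤ D →
          w.1 ^ 2 * (1 / Real.cos β ^ 2 - 1) - (Real.sqrt r + w.2.1) ^ 2 - w.2.2 ^ 2 ≤
            v.1 ^ 2 * (1 / Real.cos β ^ 2 - 1) - (Real.sqrt r + v.2.1) ^ 2 - v.2.2 ^ 2) →
      v.2.2 = 0 ∧ v.1 ^ 2 + v.2.1 ^ 2 = D) := by
  have hcos : 0 < Real.cos β := cos_pos_of_mem_Ioo ⟨by linarith [hβ.1, pi_pos], hβ.2⟩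
  have hsin : 0 < Real.sin β := sin_pos_of_pos_of_lt_pi hβ.1 (by linarith [hβ.2, pi_pos])
  have hc : 0 < Real.cos β ^ 2 := by positivity
  have hc1 : Real.cos β ^ 2 < 1 := by nlinarith [sin_sq_add_cos_sq β]
  have hs : √r ^ 2 * (Real.cos β ^ 2) ^ 2 = r * Real.cos β ^ 4 := by rw [sq_sqrt hr.le]; ring
  have key := isMaximizer_iff hc hc1 (hs.trans_le hrD.le)
  refine ⟨fun v => ?_, fun v hv => ?_⟩
  · rw [key v, hs]
    obtain ⟨x, y, z⟩ := v
    have hx : x ^ 2 = D - r * Real.cos β ^ 4 ↔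
        x = √(D - r * Real.cos β ^ 4) ∨ x = -√(D - r * Real.cos β ^ 4) := by
      rw [← sq_eq_sq_iff_eq_or_eq_neg, sq_sqrt (sub_nonneg.mpr hrD.le)]
    simp only [Prod.mk.injEq, hx, or_and_right]
  · obtain ⟨hx, hy, hz⟩ := (key v).mp hv
    refine ⟨hz, ?_⟩
    rw [hx, hy]
    ring
end

section
/- Let σ_X² > 0, σ_Z² > 0, D > 0 and β ∈ (0, π/2) with σ_Z² ≠ σ_X²·sin²β. Define r* = (D σ_Z² + 2 σ_Z² σ_X² cos²β − D σ_X² sin²β − √(D² σ_Z⁴ + 4 σ_Z⁴ σ_X⁴ cos⁴β − 2 D² σ_Z² σ_X² sin²β + D² σ_X⁴ sin⁴β)) / (2 (σ_Z² cos²β − σ_X² cos²β sin²β)) and q* = [(2 D σ_Z² + √(16 σ_Z⁴ σ_X⁴ cos⁴β + D²·(2 σ_Z² − σ_X²·(1 − cos 2β))²))·tan²β − 2 σ_X² sin²β·(2 σ_Z² + D tan²β)] / [4·(σ_Z² − σ_X² sin²β)]. Then q* = D·tan²β − r*·sin²β. -/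
open Real

/-- The paper's closed-form expressions `r*` (eq. (19)) and `q*` (eq. (20)) satisfy
`q* = D·tan²β − r*·sin²β`, i.e. `q*` is the boundary value `T₁(r*)`. -/
theorem stmt_5 (σX2 σZ2 D β : ℝ) (hX : 0 < σX2) (hZ : 0 < σZ2) (hD : 0 < D)
    (hβ : β ∈ Set.Ioo 0 (π / 2)) (hne : σZ2 ≠ σX2 * Real.sin β ^ 2) :
    let rstar : ℝ :=
      (D * σZ2 + 2 * σZ2 * σX2 * Real.cos β ^ 2 - D * σX2 * Real.sin β ^ 2 -
          Real.sqrt (D ^ 2 * σZ2 ^ 2 + 4 * σZ2 ^ 2 * σX2 ^ 2 * Real.cos β ^ 4 -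
            2 * D ^ 2 * σZ2 * σX2 * Real.sin β ^ 2 + D ^ 2 * σX2 ^ 2 * Real.sin β ^ 4)) /
        (2 * (σZ2 * Real.cos β ^ 2 - σX2 * Real.cos β ^ 2 * Real.sin β ^ 2))
    let qstar : ℝ :=
      ((2 * D * σZ2 +
            Real.sqrt (16 * σZ2 ^ 2 * σX2 ^ 2 * Real.cos β ^ 4 +
              D ^ 2 * (2 * σZ2 - σX2 * (1 - Real.cos (2 * β))) ^ 2)) * Real.tan β ^ 2 -
          2 * σX2 * Real.sin β ^ 2 * (2 * σZ2 + D * Real.tan β ^ 2)) /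
        (4 * (σZ2 - σX2 * Real.sin β ^ 2))
    qstar = D * Real.tan β ^ 2 - rstar * Real.sin β ^ 2 := by
  have hc : Real.cos β ≠ 0 :=
    (Real.cos_pos_of_mem_Ioo ⟨by linarith [hβ.1, Real.pi_pos], hβ.2⟩).ne'
  have hA : σZ2 - σX2 * Real.sin β ^ 2 ≠ 0 := sub_ne_zero.mpr hne
  have hcos : 1 - Real.cos (2 * β) = 2 * Real.sin β ^ 2 := by
    rw [Real.cos_two_mul, Real.cos_sq']; ring
  have hsqrt : Real.sqrt (16 * σZ2 ^ 2 * σX2 ^ 2 * Real.cos β ^ 4 +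
        D ^ 2 * (2 * σZ2 - σX2 * (1 - Real.cos (2 * β))) ^ 2) =
      2 * Real.sqrt (D ^ 2 * σZ2 ^ 2 + 4 * σZ2 ^ 2 * σX2 ^ 2 * Real.cos β ^ 4 -
        2 * D ^ 2 * σZ2 * σX2 * Real.sin β ^ 2 + D ^ 2 * σX2 ^ 2 * Real.sin β ^ 4) := by
    rw [hcos, ← Real.sqrt_sq (zero_le_two : (0 : ℝ) ≤ 2), ← Real.sqrt_mul (by positivity),
      Real.sqrt_sq zero_le_two]
    congr 1
    ring
  have hden : 2 * (σZ2 * Real.cos β ^ 2 - σX2 * Real.cos β ^ 2 * Real.sin β ^ 2) =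
      2 * Real.cos β ^ 2 * (σZ2 - σX2 * Real.sin β ^ 2) := by ring
  intro rstar qstar
  simp only [rstar, qstar]
  rw [hsqrt, hden, Real.tan_eq_sin_div_cos]
  generalize Real.sqrt _ = S
  generalize hAdef : σZ2 - σX2 * Real.sin β ^ 2 = A at hA ⊢
  field_simp
  rw [← hAdef]
  ring
end

section
/- Fix σ_X² > 0, D > 0 and β ∈ (0, π/2), and for σ_Z² > 0 define q*(σ_Z²) = [(2 D σ_Z² + √(16 σ_Z⁴ σ_X⁴ cos⁴β + D²·(2 σ_Z² − σ_X²·(1 − cos 2β))²))·tan²β − 2 σ_X² sin²β·(2 σ_Z² + D tan²β)] / [4·(σ_Z² − σ_X² sin²β)]. Then lim_{σ_Z² → 0⁺} q*(σ_Z²)/σ_Z² = 1. -/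
open Real Filter

/-- The quotient below vanishes at `0` with derivative `1`; here `a` and `t` stand for
`σX2 * sin β ^ 2` and `tan β ^ 2`. -/
theorem hasDerivAt_dominantNoise_zero {a D : ℝ} (ha : 0 < a) (hD : 0 < D) (k t : ℝ) :
    HasDerivAt
      (fun z : ℝ =>
        ((2 * D * z + Real.sqrt (k * z ^ 2 + D ^ 2 * (2 * z - 2 * a) ^ 2)) * t -
          2 * a * (2 * z + D * t)) / (4 * (z - a))) 1 0 := by
  have hrad : k * (0 : ℝ) ^ 2 + D ^ 2 * (2 * 0 - 2 * a) ^ 2 = (2 * D * a) ^ 2 := by ring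
  have hsqrt : Real.sqrt (k * (0 : ℝ) ^ 2 + D ^ 2 * (2 * 0 - 2 * a) ^ 2) = 2 * D * a := by
    rw [hrad, Real.sqrt_sq (by positivity)]
  have hid : HasDerivAt (fun z : ℝ => z) 1 0 := hasDerivAt_id 0
  have hq : HasDerivAt (fun z : ℝ => k * z ^ 2 + D ^ 2 * (2 * z - 2 * a) ^ 2)
      (-(8 * D ^ 2 * a)) 0 := by
    refine (((hid.fun_pow 2).const_mul k).add
      ((((hid.const_mul 2).sub_const (2 * a)).fun_pow 2).const_mul (D ^ 2))).congr_deriv ?_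
    norm_num
    ring
  have hs : HasDerivAt (fun z : ℝ => Real.sqrt (k * z ^ 2 + D ^ 2 * (2 * z - 2 * a) ^ 2))
      (-(2 * D)) 0 := by
    refine (hq.sqrt (by rw [hrad]; positivity)).congr_deriv ?_
    rw [hsqrt]
    field_simp
    norm_num
  have hnum := (((hid.const_mul (2 * D)).fun_add hs).mul_const t).fun_sub
    (((hid.const_mul 2).add_const (D * t)).const_mul (2 * a))
  have hden := (hid.sub_const a).const_mul 4
  refine (hnum.fun_div hden (by simp [ha.ne'])).congr_deriv ?_
  rw [hsqrt, zero_sub]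
  field_simp
  ring

/-- The limit of `q*(σ_Z²)/σ_Z²` as `σ_Z² → 0⁺` is `1` (eq. (24) of the paper),
where `q*` is the paper's closed-form expression (eq. (20)) for the dominant
attack-noise energy. -/
theorem stmt_7 (σX2 D β : ℝ) (hX : 0 < σX2) (hD : 0 < D) (hβ : β ∈ Set.Ioo 0 (π / 2)) :
    Tendsto
      (fun σZ2 : ℝ =>
        (((2 * D * σZ2 +
              Real.sqrt (16 * σZ2 ^ 2 * σX2 ^ 2 * Real.cos β ^ 4 +
                D ^ 2 * (2 * σZ2 - σX2 * (1 - Real.cos (2 * β))) ^ 2)) * Real.tan β ^ 2 -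
            2 * σX2 * Real.sin β ^ 2 * (2 * σZ2 + D * Real.tan β ^ 2)) /
          (4 * (σZ2 - σX2 * Real.sin β ^ 2))) / σZ2)
      (nhdsWithin 0 (Set.Ioi 0)) (nhds 1) := by
  have hs : 0 < Real.sin β :=
    Real.sin_pos_of_pos_of_lt_pi hβ.1 (by linarith [hβ.2, Real.pi_pos])
  have hcos : 1 - Real.cos (2 * β) = 2 * Real.sin β ^ 2 := by
    rw [Real.cos_two_mul, Real.cos_sq']
    ring
  have ha : 0 < σX2 * Real.sin β ^ 2 := by positivity
  have hlim := (hasDerivAt_dominantNoise_zero ha hD (16 * σX2 ^ 2 * Real.cos β ^ 4)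
    (Real.tan β ^ 2)).tendsto_slope.mono_left
      (nhdsWithin_mono 0 fun z (hz : 0 < z) => hz.ne')
  refine hlim.congr fun z => ?_
  have hzero : Real.sqrt (16 * σX2 ^ 2 * Real.cos β ^ 4 * (0 : ℝ) ^ 2 +
      D ^ 2 * (2 * 0 - 2 * (σX2 * Real.sin β ^ 2)) ^ 2) = 2 * D * (σX2 * Real.sin β ^ 2) := by
    rw [← Real.sqrt_sq (show 0 ≤ 2 * D * (σX2 * Real.sin β ^ 2) by positivity)]
    ring_nf
  have hrad : 16 * σX2 ^ 2 * Real.cos β ^ 4 * z ^ 2 +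
      D ^ 2 * (2 * z - 2 * (σX2 * Real.sin β ^ 2)) ^ 2 =
      16 * z ^ 2 * σX2 ^ 2 * Real.cos β ^ 4 +
        D ^ 2 * (2 * z - σX2 * (2 * Real.sin β ^ 2)) ^ 2 := by ring
  rw [slope_def_field, hzero, hrad, hcos]
  ring
end

section
/- Fix σ_X² > 0, D > 0 and β ∈ (0, π/2), and for σ_Z² > 0 define r*(σ_Z²) and q*(σ_Z²) by the paper's closed-form formulas r* = (D σ_Z² + 2 σ_Z² σ_X² cos²β − D σ_X² sin²β − √(D² σ_Z⁴ + 4 σ_Z⁴ σ_X⁴ cos⁴β − 2 D² σ_Z² σ_X² sin²β + D² σ_X⁴ sin⁴β)) / (2 (σ_Z² cos²β − σ_X² cos²β sin²β)) and q* = [(2 D σ_Z² + √(16 σ_Z⁴ σ_X⁴ cos⁴β + D²·(2 σ_Z² − σ_X²·(1 − cos 2β))²))·tan²β − 2 σ_X² sin²β·(2 σ_Z² + D tan²β)] / [4·(σ_Z² − σ_X² sin²β)], and let E(σ_Z²) = (1/2)·[q*/σ_Z² − ln(q*/σ_Z²) − 1] + (1/2)·[r*/σ_X² − ln(r*/σ_X²)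 − 1]. Then lim_{σ_Z² → 0⁺} E(σ_Z²) = (1/2)·[D/(σ_X² cos²β) − ln(D/(σ_X² cos²β)) − 1]. -/
open Real Filter

/-- A nonnegative square root of a perturbed square, with the difference rationalized. -/
lemma sqrt_sub_eq_div_add {a b : ℝ} (hb : 0 < b) (ha : 0 ≤ a) :
    √(a + b ^ 2) - b = a / (√(a + b ^ 2) + b) := by
  have hpos : 0 < √(a + b ^ 2) + b := by positivity
  have hsq : √(a + b ^ 2) ^ 2 = a + b ^ 2 := Real.sq_sqrt (by positivity)
  rw [eq_div_iff hpos.ne']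
  linear_combination hsq

/-- The ratio `q* / z` for small positive `z`, with the removable singularity at `0` removed. -/
lemma qstar_div_eq {X D β z : ℝ} (hX : 0 < X) (hD : 0 < D) (hc : 0 < cos β) (hz : 0 < z)
    (hzX : z < X * sin β ^ 2) :
    ((2 * D * z +
          √(16 * z ^ 2 * X ^ 2 * cos β ^ 4 +
            D ^ 2 * (2 * z - X * (1 - cos (2 * β))) ^ 2)) * tan β ^ 2 -
        2 * X * sin β ^ 2 * (2 * z + D * tan β ^ 2)) /
      (4 * (z - X * sin β ^ 2)) / z =
    tan β ^ 2 * (16 * z * X ^ 2 * cos β ^ 4 /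
        (√(16 * z ^ 2 * X ^ 2 * cos β ^ 4 + (2 * D * (X * sin β ^ 2 - z)) ^ 2) +
          2 * D * (X * sin β ^ 2 - z)) - 4 * X * cos β ^ 2) /
      (4 * (z - X * sin β ^ 2)) := by
  have hb : 0 < 2 * D * (X * sin β ^ 2 - z) := by
    have := sub_pos.2 hzX
    positivity
  have harg : 16 * z ^ 2 * X ^ 2 * cos β ^ 4 + D ^ 2 * (2 * z - X * (1 - cos (2 * β))) ^ 2 =
      16 * z ^ 2 * X ^ 2 * cos β ^ 4 + (2 * D * (X * sin β ^ 2 - z)) ^ 2 := by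
    rw [Real.cos_two_mul, Real.cos_sq']
    ring
  have hsub := sqrt_sub_eq_div_add (a := 16 * z ^ 2 * X ^ 2 * cos β ^ 4) hb (by positivity)
  have hsin : sin β ^ 2 = tan β ^ 2 * cos β ^ 2 := by
    rw [← mul_pow, Real.tan_mul_cos hc.ne']
  rw [harg, div_right_comm]
  congr 1
  rw [div_eq_iff hz.ne']
  linear_combination tan β ^ 2 * hsub - 4 * X * z * hsin

/-- The optimal noise variance is asymptotic to the attack-noise variance. -/
lemma tendsto_qstar_div {X D β : ℝ} (hX : 0 < X) (hD : 0 < D) (hs : 0 < sin β)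
    (hc : 0 < cos β) :
    Tendsto (fun z : ℝ =>
      ((2 * D * z +
            √(16 * z ^ 2 * X ^ 2 * cos β ^ 4 +
              D ^ 2 * (2 * z - X * (1 - cos (2 * β))) ^ 2)) * tan β ^ 2 -
          2 * X * sin β ^ 2 * (2 * z + D * tan β ^ 2)) /
        (4 * (z - X * sin β ^ 2)) / z)
      (nhdsWithin 0 (Set.Ioi 0)) (nhds 1) := by
  have hXs : 0 < X * sin β ^ 2 := by positivity
  have hcont : ContinuousAt (fun z : ℝ =>
      tan β ^ 2 * (16 * z * X ^ 2 * cos β ^ 4 /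
          (√(16 * z ^ 2 * X ^ 2 * cos β ^ 4 + (2 * D * (X * sin β ^ 2 - z)) ^ 2) +
            2 * D * (X * sin β ^ 2 - z)) - 4 * X * cos β ^ 2) /
        (4 * (z - X * sin β ^ 2))) 0 := by
    have h1 : √(16 * (0 : ℝ) ^ 2 * X ^ 2 * cos β ^ 4 + (2 * D * (X * sin β ^ 2 - 0)) ^ 2) +
        2 * D * (X * sin β ^ 2 - 0) ≠ 0 := by
      rw [sub_zero]
      positivity
    have h2 : 4 * (0 - X * sin β ^ 2) ≠ 0 := by
      rw [zero_sub]
      exact mul_ne_zero four_ne_zero (neg_ne_zero.2 hXs.ne')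
    fun_prop (disch := assumption)
  have hlim := hcont.tendsto.mono_left (nhdsWithin_le_nhds (s := Set.Ioi 0))
  have hval : tan β ^ 2 * (16 * 0 * X ^ 2 * cos β ^ 4 /
          (√(16 * 0 ^ 2 * X ^ 2 * cos β ^ 4 + (2 * D * (X * sin β ^ 2 - 0)) ^ 2) +
            2 * D * (X * sin β ^ 2 - 0)) - 4 * X * cos β ^ 2) /
        (4 * (0 - X * sin β ^ 2)) = 1 := by
    rw [Real.tan_eq_sin_div_cos]
    simp only [mul_zero, zero_mul, zero_div, zero_sub]
    field_simp
  rw [hval] at hlim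
  refine hlim.congr' ?_
  filter_upwards [self_mem_nhdsWithin, nhdsWithin_le_nhds (Iio_mem_nhds hXs)] with z hz hzX
  exact (qstar_div_eq hX hD hc hz hzX).symm

/-- The optimal host variance tends to `D / cos² β` as the attack noise vanishes. -/
lemma tendsto_rstar {X D β : ℝ} (hX : 0 < X) (hD : 0 < D) (hs : 0 < sin β) (hc : 0 < cos β) :
    Tendsto (fun z : ℝ =>
      (D * z + 2 * z * X * cos β ^ 2 - D * X * sin β ^ 2 -
          √(D ^ 2 * z ^ 2 + 4 * z ^ 2 * X ^ 2 * cos β ^ 4 -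
            2 * D ^ 2 * z * X * sin β ^ 2 + D ^ 2 * X ^ 2 * sin β ^ 4)) /
        (2 * (z * cos β ^ 2 - X * cos β ^ 2 * sin β ^ 2)))
      (nhdsWithin 0 (Set.Ioi 0)) (nhds (D / cos β ^ 2)) := by
  have hcont : ContinuousAt (fun z : ℝ =>
      (D * z + 2 * z * X * cos β ^ 2 - D * X * sin β ^ 2 -
          √(D ^ 2 * z ^ 2 + 4 * z ^ 2 * X ^ 2 * cos β ^ 4 -
            2 * D ^ 2 * z * X * sin β ^ 2 + D ^ 2 * X ^ 2 * sin β ^ 4)) /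
        (2 * (z * cos β ^ 2 - X * cos β ^ 2 * sin β ^ 2))) 0 := by
    have h : 2 * (0 * cos β ^ 2 - X * cos β ^ 2 * sin β ^ 2) ≠ 0 := by
      rw [zero_mul, zero_sub]
      exact mul_ne_zero two_ne_zero (neg_ne_zero.2 (by positivity))
    fun_prop (disch := assumption)
  have hlim := hcont.tendsto.mono_left (nhdsWithin_le_nhds (s := Set.Ioi 0))
  have hsqrt : √(D ^ 2 * 0 ^ 2 + 4 * 0 ^ 2 * X ^ 2 * cos β ^ 4 -
      2 * D ^ 2 * 0 * X * sin β ^ 2 + D ^ 2 * X ^ 2 * sin β ^ 4) = D * X * sin β ^ 2 := by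
    rw [← Real.sqrt_sq (show 0 ≤ D * X * sin β ^ 2 by positivity)]
    congr 1
    ring
  have hval : (D * 0 + 2 * 0 * X * cos β ^ 2 - D * X * sin β ^ 2 - D * X * sin β ^ 2) /
      (2 * (0 * cos β ^ 2 - X * cos β ^ 2 * sin β ^ 2)) = D / cos β ^ 2 := by
    simp only [mul_zero, zero_mul, zero_add, zero_sub]
    field_simp
    ring
  rwa [hsqrt, hval] at hlim

/-- The optimal false-negative error exponent `E(σ_Z²)` (eq. (21) of the paper,
built from the closed-form `r*` and `q*` of eqs. (19)–(20)) tends, as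
`σ_Z² → 0⁺`, to the attack-free exponent
`(1/2)·[D/(σ_X² cos²β) − ln(D/(σ_X² cos²β)) − 1]` (eq. (25), nonzero branch). -/
theorem stmt_8 (σX2 D β : ℝ) (hX : 0 < σX2) (hD : 0 < D) (hβ : β ∈ Set.Ioo 0 (π / 2)) :
    Tendsto
      (fun σZ2 : ℝ =>
        let rstar : ℝ :=
          (D * σZ2 + 2 * σZ2 * σX2 * Real.cos β ^ 2 - D * σX2 * Real.sin β ^ 2 -
              Real.sqrt (D ^ 2 * σZ2 ^ 2 + 4 * σZ2 ^ 2 * σX2 ^ 2 * Real.cos β ^ 4 -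
                2 * D ^ 2 * σZ2 * σX2 * Real.sin β ^ 2 + D ^ 2 * σX2 ^ 2 * Real.sin β ^ 4)) /
            (2 * (σZ2 * Real.cos β ^ 2 - σX2 * Real.cos β ^ 2 * Real.sin β ^ 2))
        let qstar : ℝ :=
          ((2 * D * σZ2 +
                Real.sqrt (16 * σZ2 ^ 2 * σX2 ^ 2 * Real.cos β ^ 4 +
                  D ^ 2 * (2 * σZ2 - σX2 * (1 - Real.cos (2 * β))) ^ 2)) * Real.tan β ^ 2 -
              2 * σX2 * Real.sin β ^ 2 * (2 * σZ2 + D * Real.tan β ^ 2)) /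
            (4 * (σZ2 - σX2 * Real.sin β ^ 2))
        (1 / 2) * (qstar / σZ2 - Real.log (qstar / σZ2) - 1) +
          (1 / 2) * (rstar / σX2 - Real.log (rstar / σX2) - 1))
      (nhdsWithin 0 (Set.Ioi 0))
      (nhds ((1 / 2) * (D / (σX2 * Real.cos β ^ 2) -
        Real.log (D / (σX2 * Real.cos β ^ 2)) - 1))) := by
  have hs : 0 < sin β := sin_pos_of_mem_Ioo ⟨hβ.1, by linarith [hβ.2, pi_pos]⟩
  have hc : 0 < cos β := cos_pos_of_mem_Ioo ⟨by linarith [hβ.1, pi_pos], hβ.2⟩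
  have hq := tendsto_qstar_div hX hD hs hc
  have hr := (tendsto_rstar hX hD hs hc).div_const σX2
  have hne : D / cos β ^ 2 / σX2 ≠ 0 := by positivity
  have hsum := (((hq.sub (hq.log one_ne_zero)).sub_const 1).const_mul (1 / 2)).add
    (((hr.sub (hr.log hne)).sub_const 1).const_mul (1 / 2))
  have hval : D / (σX2 * cos β ^ 2) = D / cos β ^ 2 / σX2 := by
    rw [div_div, mul_comm]
  rw [hval]
  simpa only [log_one, sub_zero, sub_self, mul_zero, zero_add] using hsum
end

section
/- Let β ∈ (0, π/2]. Then lim_{n → ∞} (1/n)·ln( (∫₀^β sin^{n−2}φ dφ) / (∫₀^π sin^{n−2}φ dφ) ) = ln(sin β). -/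
open Real Filter

theorem mul_sin_div_le_sin {β x : ℝ} (hβ : 0 < β) (hβ' : β ≤ π) (hx : x ∈ Set.Icc 0 β) :
    sin β / β * x ≤ sin x := by
  have hβmem : β ∈ Set.Icc 0 π := ⟨hβ.le, hβ'⟩
  have h0mem : (0 : ℝ) ∈ Set.Icc 0 π := ⟨le_rfl, pi_pos.le⟩
  have h := strictConcaveOn_sin_Icc.concaveOn.2 hβmem h0mem (div_nonneg hx.1 hβ.le)
    (sub_nonneg.2 ((div_le_one hβ).2 hx.2)) (by ring)
  simp only [smul_eq_mul, sin_zero, mul_zero, add_zero, div_mul_cancel₀ _ hβ.ne'] at h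
  calc sin β / β * x = x / β * sin β := by ring
    _ ≤ sin x := h

theorem le_integral_sin_pow {β : ℝ} (hβ : 0 < β) (hβ' : β ≤ π) (m : ℕ) :
    sin β ^ m * β / (m + 1) ≤ ∫ φ in (0 : ℝ)..β, sin φ ^ m := by
  have h : ∫ φ in (0 : ℝ)..β, (sin β / β * φ) ^ m = sin β ^ m * β / (m + 1) := by
    simp only [mul_pow, intervalIntegral.integral_const_mul, integral_pow, div_pow]
    field_simp
    simp [pow_succ, mul_assoc]
  rw [← h]
  refine intervalIntegral.integral_mono_on hβ.le
    (Continuous.intervalIntegrable (by fun_prop) _ _)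
    (Continuous.intervalIntegrable (by fun_prop) _ _) fun x hx => ?_
  exact pow_le_pow_left₀
    (mul_nonneg (div_nonneg (sin_nonneg_of_nonneg_of_le_pi hβ.le hβ') hβ.le) hx.1)
    (mul_sin_div_le_sin hβ hβ' hx) m

theorem integral_sin_pow_le_of_sin_le {β s : ℝ} (hβ : 0 ≤ β) (hβ' : β ≤ π)
    (hs : ∀ x ∈ Set.Icc 0 β, sin x ≤ s) (m : ℕ) :
    ∫ φ in (0 : ℝ)..β, sin φ ^ m ≤ s ^ m * β := by
  have h : ∫ _ in (0 : ℝ)..β, s ^ m = s ^ m * β := by simp [mul_comm]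
  rw [← h]
  refine intervalIntegral.integral_mono_on hβ
    (Continuous.intervalIntegrable (by fun_prop) _ _)
    (Continuous.intervalIntegrable (by fun_prop) _ _) fun x hx => ?_
  exact pow_le_pow_left₀ (sin_nonneg_of_nonneg_of_le_pi hx.1 (hx.2.trans hβ')) (hs x hx) m

theorem half_pi_div_le_integral_sin_pow (m : ℕ) :
    π / 2 / (m + 1) ≤ ∫ φ in (0 : ℝ)..π, sin φ ^ m := by
  have h := le_integral_sin_pow (by positivity : (0 : ℝ) < π / 2) (by linarith [pi_pos]) m
  rw [sin_pi_div_two, one_pow, one_mul] at h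
  refine h.trans (intervalIntegral.integral_mono_interval le_rfl (by positivity)
    (by linarith [pi_pos]) ?_ (Continuous.intervalIntegrable (by fun_prop) _ _))
  refine (MeasureTheory.ae_restrict_iff' measurableSet_Ioc).2 (.of_forall fun x hx => ?_)
  exact pow_nonneg (sin_nonneg_of_nonneg_of_le_pi hx.1.le hx.2) m

/-- A sequence equal to `s ^ m` up to a factor of linear growth has exponential rate `log s`,
also after a shift of the index by two. -/
theorem tendsto_log_div_of_pow_bounds {g : ℕ → ℝ} {s c C : ℝ} (hs : 0 < s) (hc : 0 < c)
    (hC : 0 < C) (hl : ∀ m : ℕ, c * s ^ m / (m + 1) ≤ g m)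
    (hu : ∀ m : ℕ, g m ≤ C * s ^ m * (m + 1)) :
    Tendsto (fun n : ℕ => 1 / (n : ℝ) * log (g (n - 2))) atTop (nhds (log s)) := by
  have hinv : Tendsto (fun n : ℕ => 1 / (n : ℝ)) atTop (nhds 0) :=
    tendsto_one_div_atTop_nhds_zero_nat
  have hlog : Tendsto (fun n : ℕ => 1 / (n : ℝ) * log n) atTop (nhds 0) := by
    have h := (isLittleO_log_id_atTop.tendsto_div_nhds_zero).comp
      (tendsto_natCast_atTop_atTop (R := ℝ))
    refine h.congr fun n => ?_
    simp [div_eq_inv_mul]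
  have hlow : Tendsto (fun n : ℕ => log s + 1 / (n : ℝ) * (log c - 2 * log s)
      - 1 / (n : ℝ) * log n) atTop (nhds (log s)) := by
    simpa using ((hinv.mul_const (log c - 2 * log s)).const_add (log s)).sub hlog
  have hupp : Tendsto (fun n : ℕ => log s + 1 / (n : ℝ) * (log C - 2 * log s)
      + 1 / (n : ℝ) * log n) atTop (nhds (log s)) := by
    simpa using ((hinv.mul_const (log C - 2 * log s)).const_add (log s)).add hlog
  refine tendsto_of_tendsto_of_tendsto_of_le_of_le' hlow hupp ?_ ?_
  all_goals
    filter_upwards [eventually_ge_atTop 2] with n hn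
    obtain ⟨m, rfl⟩ := Nat.exists_eq_add_of_le' hn
    have hm : (0 : ℝ) < (m : ℝ) + 1 := by positivity
    have hm2 : (0 : ℝ) < (m : ℝ) + 2 := by positivity
    have hmono : log ((m : ℝ) + 1) ≤ log ((m : ℝ) + 2) := log_le_log hm (by linarith)
    have hpow : (0 : ℝ) < s ^ m := pow_pos hs m
    have hpos : 0 < g m := lt_of_lt_of_le (by positivity) (hl m)
    simp only [Nat.add_sub_cancel]
    push_cast
  · have h := log_le_log (by positivity) (hl m)
    rw [log_div (by positivity) hm.ne', log_mul hc.ne' hpow.ne', log_pow] at h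
    calc _ = 1 / ((m : ℝ) + 2) * (log c + m * log s - log (m + 2)) := by field_simp; ring
      _ ≤ _ := by gcongr; linarith
  · have h := log_le_log hpos (hu m)
    rw [log_mul (by positivity) hm.ne', log_mul hC.ne' hpow.ne', log_pow] at h
    calc _ ≤ 1 / ((m : ℝ) + 2) * (log C + m * log s + log (m + 2)) := by gcongr; linarith
      _ = _ := by field_simp; ring

/-- The false-positive probability `2A_n(β)/A_n(π)` of the hypercone detector of
half-angle `β ∈ (0, π/2]` decays exponentially with exponent `−ln(sin β)`:
`lim_{n→∞} (1/n)·ln(∫₀^β sin^{n−2}φ dφ / ∫₀^π sin^{n−2}φ dφ) = ln(sin β)`. -/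
theorem stmt_13 (β : ℝ) (hβ : β ∈ Set.Ioc 0 (π / 2)) :
    Tendsto
      (fun n : ℕ =>
        (1 / (n : ℝ)) * Real.log
          ((∫ φ in (0 : ℝ)..β, Real.sin φ ^ (n - 2)) /
           (∫ φ in (0 : ℝ)..π, Real.sin φ ^ (n - 2))))
      atTop (nhds (Real.log (Real.sin β))) := by
  obtain ⟨h0, h2⟩ := hβ
  have hπ : β ≤ π := by linarith [pi_pos]
  have hs : 0 < sin β := sin_pos_of_pos_of_lt_pi h0 (by linarith [pi_pos])
  have hsin : ∀ x ∈ Set.Icc 0 β, sin x ≤ sin β := fun x hx =>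
    sin_le_sin_of_le_of_le_pi_div_two (by linarith [hx.1, pi_pos]) h2 hx.2
  refine tendsto_log_div_of_pow_bounds
    (g := fun m : ℕ => (∫ φ in (0 : ℝ)..β, sin φ ^ m) / ∫ φ in (0 : ℝ)..π, sin φ ^ m)
    hs (div_pos h0 pi_pos) (div_pos h0 (half_pos pi_pos)) (fun m => ?_) (fun m => ?_)
  · have hπint : ∫ φ in (0 : ℝ)..π, sin φ ^ m ≤ π := by
      simpa using integral_sin_pow_le_of_sin_le pi_pos.le le_rfl (fun x _ => sin_le_one x) m
    have hlow := le_integral_sin_pow h0 hπ m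
    have hpos : 0 < ∫ φ in (0 : ℝ)..π, sin φ ^ m := integral_sin_pow_pos m
    calc β / π * sin β ^ m / (m + 1) = sin β ^ m * β / (m + 1) / π := by ring
      _ ≤ _ := div_le_div₀ (le_trans (by positivity) hlow) hlow hpos hπint
  · have hupp := integral_sin_pow_le_of_sin_le h0.le hπ hsin m
    have hm : (0 : ℝ) < (m : ℝ) + 1 := by positivity
    calc _ ≤ sin β ^ m * β / (π / 2 / (m + 1)) :=
          div_le_div₀ (by positivity) hupp (by positivity) (half_pi_div_le_integral_sin_pow m)
      _ = β / (π / 2) * sin β ^ m * (m + 1) := by field_simp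
end
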